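/- Let Δx > 0, x_m = m·Δx, and let h : ℝ → ℝ be a polynomial of degree at most 2 with cell averages f_m = (1/Δx)·∫_{x_m−Δx/2}^{x_m+Δx/2} h(ξ) dξ. Let δ⁻ = f_i − f_{i−1} and δ⁺ = f_{i+1} − f_i. Then the unlimited MUSCL reconstruction with κ = 1/3, namely f_i + (1/4)[(1 − κ)δ⁻ + (1 + κ)δ⁺], equals (−f_{i−1} + 5f_i + 2f_{i+1})/6 and coincides with h(x_i + Δx/2); that is, setting κ = 1/3 with slope function identically 1 restores a third-order reconstruction. -/

import Mathlib

/-- A real polynomial of degree at most 2 evaluates as a quadratic in its coefficients. -/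
theorem eval_eq_of_degree_le_two {p : Polynomial ℝ} (hp : p.degree ≤ 2) (x : ℝ) :
    p.eval x = p.coeff 0 + p.coeff 1 * x + p.coeff 2 * x ^ 2 := by
  have hlt : p.natDegree < 3 := Nat.lt_succ_of_le (Polynomial.natDegree_le_of_degree_le hp)
  rw [Polynomial.eval_eq_sum_range' hlt]
  simp [Finset.sum_range_succ]

/-- The integral of a quadratic over an interval. -/
theorem integral_quadratic (a b c u v : ℝ) :
    ∫ x in u..v, (a + b * x + c * x ^ 2) =
      a * (v - u) + b * ((v ^ 2 - u ^ 2) / 2) + c * ((v ^ 3 - u ^ 3) / 3) := by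
  rw [intervalIntegral.integral_add, intervalIntegral.integral_add]
  · simp only [intervalIntegral.integral_const, intervalIntegral.integral_const_mul, integral_pow,
      intervalIntegral.integral_const_mul b (fun x : ℝ => x), integral_id, smul_eq_mul]
    norm_num
    ring
  all_goals exact Continuous.intervalIntegrable (by fun_prop) _ _

/-- The cell average of a polynomial of degree at most 2 over a cell centred at `x`. -/
theorem cell_average_of_degree_le_two {p : Polynomial ℝ} (hp : p.degree ≤ 2) {d : ℝ}
    (hd : d ≠ 0) (x : ℝ) :
    (1 / d) * ∫ ξ in (x - d / 2)..(x + d / 2), p.eval ξ =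
      p.coeff 0 + p.coeff 1 * x + p.coeff 2 * (x ^ 2 + d ^ 2 / 12) := by
  simp only [eval_eq_of_degree_le_two hp, integral_quadratic]
  field_simp
  ring

/-- The unlimited MUSCL reconstruction with `κ = 1/3` (slope function ≡ 1)
equals `(-f_{i-1} + 5 f_i + 2 f_{i+1})/6` and restores the third-order
point value `h (x_i + Δx/2)` for polynomials of degree at most 2. -/
theorem muscl_kappa_third_order (Δx : ℝ) (hΔx : 0 < Δx) (h : Polynomial ℝ)
    (hdeg : h.degree ≤ 2)
    (f : ℤ → ℝ)
    (hf : ∀ m : ℤ, f m =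
      (1 / Δx) * ∫ ξ in ((m : ℝ) * Δx - Δx / 2)..((m : ℝ) * Δx + Δx / 2), h.eval ξ)
    (i : ℤ) (κ δm δp : ℝ) (hκ : κ = 1 / 3)
    (hδm : δm = f i - f (i - 1)) (hδp : δp = f (i + 1) - f i) :
    f i + (1 / 4) * ((1 - κ) * δm + (1 + κ) * δp)
        = (-f (i - 1) + 5 * f i + 2 * f (i + 1)) / 6 ∧
      f i + (1 / 4) * ((1 - κ) * δm + (1 + κ) * δp)
        = h.eval ((i : ℝ) * Δx + Δx / 2) := by
  subst hκ hδm hδp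
  refine ⟨by ring, ?_⟩
  simp only [hf, cell_average_of_degree_le_two hdeg hΔx.ne']
  rw [eval_eq_of_degree_le_two hdeg]
  push_cast
  ring
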